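/- Let b ∈ bmo(ℝⁿ), i.e. b is locally integrable with ‖b‖_bmo := sup over balls B of the average over B of |b − c_B| finite, where c_B = (average of b over B) if r(B) < 1 and c_B = 0 if r(B) ≥ 1. Then for any δ > 0 and p ≥ 1 there is a constant C = C(n,p,δ), independent of b, x₀, r, such that r^δ ∫_{|x−x₀|>r} |b(x) − c_{B(x₀,r)}|^p / |x−x₀|^{n+δ} dx ≤ C ‖b‖_bmo^p. -/

import Mathlib

open MeasureTheory Metric Real Set

/-- The constant `c_B` of nonhomogeneous BMO: the mean of `b` over the ball when the
radius is smaller than 1, and `0` otherwise. -/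
noncomputable def cB (n : ℕ) (b : EuclideanSpace ℝ (Fin n) → ℝ)
    (x₀ : EuclideanSpace ℝ (Fin n)) (r : ℝ) : ℝ :=
  if r < 1 then ⨍ x in Metric.ball x₀ r, b x else 0


namespace BmoTail
open Filter Topology

/-- volume of the unit ball -/
noncomputable def ww (n : ℕ) : ℝ := volume.real (ball (0 : EuclideanSpace ℝ (Fin n)) 1)

lemma ww_pos (n : ℕ) : 0 < ww n := by
  unfold ww
  exact ENNReal.toReal_pos (measure_ball_pos _ _ one_pos).ne' measure_ball_lt_top.ne

lemma vol_ball (n : ℕ) (x : EuclideanSpace ℝ (Fin n)) {r : ℝ} (hr : 0 < r) :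
    volume.real (ball x r) = r ^ n * ww n := by
  unfold ww
  rw [measureReal_def, Measure.addHaar_ball_of_pos _ _ hr, ENNReal.toReal_mul,
    ENNReal.toReal_ofReal (by positivity), measureReal_def]
  simp

lemma vol_ball' (n : ℕ) (x : EuclideanSpace ℝ (Fin n)) {r : ℝ} (hr : 0 < r) :
    volume (ball x r) = ENNReal.ofReal (r ^ n * ww n) := by
  rw [← vol_ball n x hr, measureReal_def, ENNReal.ofReal_toReal measure_ball_lt_top.ne]

lemma intOn {n : ℕ} {b : EuclideanSpace ℝ (Fin n) → ℝ} (hb : LocallyIntegrable b volume)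
    (c : ℝ) (x : EuclideanSpace ℝ (Fin n)) (r : ℝ) :
    IntegrableOn (fun y => b y - c) (ball x r) volume := by
  have h := hb.sub (locallyIntegrable_const c)
  exact (h.integrableOn_isCompact (isCompact_closedBall x r)).mono_set ball_subset_closedBall

lemma intOnAbs {n : ℕ} {b : EuclideanSpace ℝ (Fin n) → ℝ} (hb : LocallyIntegrable b volume)
    (c : ℝ) (x : EuclideanSpace ℝ (Fin n)) (r : ℝ) :
    IntegrableOn (fun y => |b y - c|) (ball x r) volume := (intOn hb c x r).abs

lemma avg_eq (n : ℕ) (f : EuclideanSpace ℝ (Fin n) → ℝ) (x : EuclideanSpace ℝ (Fin n)) {r : ℝ}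
    (hr : 0 < r) : (⨍ y in ball x r, f y) * (r ^ n * ww n) = ∫ y in ball x r, f y := by
  have := ww_pos n
  rw [setAverage_eq, vol_ball n x hr, smul_eq_mul]
  field_simp

lemma cdiff {n : ℕ} {b : EuclideanSpace ℝ (Fin n) → ℝ} (hb : LocallyIntegrable b volume)
    (x x' : EuclideanSpace ℝ (Fin n)) {r r' : ℝ} (hr' : 0 < r') (h : r' ≤ r) :
    |cB n b x' r' - cB n b x r| * (r' ^ n * ww n) ≤ ∫ y in ball x' r', |b y - cB n b x r| := by
  have hw := ww_pos n
  by_cases h1 : r' < 1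
  · set c := cB n b x r
    have hv : 0 < r' ^ n * ww n := by positivity
    rw [← abs_of_pos hv, ← abs_mul, sub_mul]
    have : cB n b x' r' * (r' ^ n * ww n) - c * (r' ^ n * ww n) = ∫ y in ball x' r', (b y - c) := by
      rw [integral_sub]
      · simp only [cB, h1, if_true]
        rw [avg_eq n b x' hr', setIntegral_const, vol_ball n x' hr', smul_eq_mul, mul_comm c]
      · have := intOn hb 0 x' r'
        simp only [sub_zero] at this
        exact this
      · exact integrableOn_const measure_ball_lt_top.ne
    rw [this]
    exact abs_integral_le_integral_abs
  · have h2 : ¬ r < 1 := by linarith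
    simp only [cB, h1, h2, if_false]
    simp
    positivity

/-- the bmo condition in integral form -/
def Hyp (n : ℕ) (b : EuclideanSpace ℝ (Fin n) → ℝ) (N : ℝ) : Prop :=
  ∀ (x : EuclideanSpace ℝ (Fin n)) (r : ℝ), 0 < r →
    ∫ y in ball x r, |b y - cB n b x r| ≤ N * (r ^ n * ww n)

/-- distribution bound -/
def P (n : ℕ) (b : EuclideanSpace ℝ (Fin n) → ℝ) (t ε : ℝ) : Prop :=
  ∀ (x : EuclideanSpace ℝ (Fin n)) (R : ℝ), 0 < R →
    volume {y | y ∈ ball x R ∧ t < |b y - cB n b x (2 * R)|} ≤ ENNReal.ofReal (ε * (R ^ n * ww n))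

lemma leb {n : ℕ} {b : EuclideanSpace ℝ (Fin n) → ℝ} (hb : LocallyIntegrable b volume)
    (c : ℝ) {R : ℝ} (hR : 0 < R) : ∀ᵐ x : EuclideanSpace ℝ (Fin n), ∀ l : ℝ, l < |b x - c| →
      ∃ k : ℕ, l * ((R * (1 / 10) ^ k) ^ n * ww n) <
        ∫ y in ball x (R * (1 / 10) ^ k), |b y - c| := by
  have hL : LocallyIntegrable (fun y => |b y - c|) volume := by
    intro x
    obtain ⟨s, hs, hi⟩ := (hb.sub (locallyIntegrable_const c)) x
    exact ⟨s, hs, hi.abs⟩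
  filter_upwards [IsUnifLocDoublingMeasure.ae_tendsto_average volume hL 1] with x hx l hl
  have hpos : ∀ k : ℕ, 0 < R * (1 / 10 : ℝ) ^ k := fun k => by positivity
  have h0 : Tendsto (fun k : ℕ => R * (1 / 10 : ℝ) ^ k) atTop (𝓝[>] 0) := by
    rw [tendsto_nhdsWithin_iff]
    refine ⟨?_, Eventually.of_forall fun k => hpos k⟩
    simpa using (tendsto_pow_atTop_nhds_zero_of_lt_one (r := (1 / 10 : ℝ)) (by norm_num)
      (by norm_num)).const_mul R
  have h1 := hx (fun _ : ℕ => x) _ h0 (Eventually.of_forall fun k => by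
    simpa using (hpos k).le)
  obtain ⟨k, hk⟩ := (h1.eventually (lt_mem_nhds hl)).exists
  refine ⟨k, ?_⟩
  have he : closedBall x (R * (1 / 10 : ℝ) ^ k) =ᵐ[volume] ball x (R * (1 / 10 : ℝ) ^ k) := by
    rw [← ball_union_sphere]
    exact union_ae_eq_left_of_ae_eq_empty
      (ae_eq_empty.2 (Measure.addHaar_sphere_of_ne_zero _ _ (hpos k).ne'))
  rw [setAverage_congr he] at hk
  rw [← avg_eq n _ x (hpos k)]
  have := ww_pos n
  have := hpos k
  exact mul_lt_mul_of_pos_right hk (by positivity)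

lemma step {n : ℕ} {b : EuclideanSpace ℝ (Fin n) → ℝ} (hb : LocallyIntegrable b volume)
    {N : ℝ} (hN : 0 < N) (hyp : Hyp n b N) {t ε : ℝ} (ht : 0 ≤ t) (hε : 0 ≤ ε) (hP : P n b t ε) :
    P n b (t + 2 * 20 ^ n * N) (ε / 2) := by
  intro x0 R hR
  have hw := ww_pos n
  set l : ℝ := 2 * 20 ^ n * N with hl
  have hlpos : 0 < l := by positivity
  set c := cB n b x0 (2 * R) with hc
  set G := {y | y ∈ ball x0 R ∧ t + l < |b y - c|} with hG
  set ρ : ℕ → ℝ := fun k => R * (1 / 10 : ℝ) ^ k with hρ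
  have hρpos : ∀ k, 0 < ρ k := fun k => by simp only [hρ]; positivity
  -- total mass
  have hmass : ∫ y in ball x0 (2 * R), |b y - c| ≤ N * ((2 * R) ^ n * ww n) :=
    hyp x0 (2 * R) (by positivity)
  have hnn : ∀ s : Set (EuclideanSpace ℝ (Fin n)), 0 ≤ ∫ y in s, |b y - c| :=
    fun s => integral_nonneg fun y => abs_nonneg _
  -- choice of radii
  have stopping : ∀ᵐ x : EuclideanSpace ℝ (Fin n), x ∈ G → ∃ s : ℝ, 0 < s ∧ s ≤ R / 10 ∧
      l * (s ^ n * ww n) < ∫ y in ball x s, |b y - c| ∧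
      ∫ y in ball x (10 * s), |b y - c| ≤ l * ((10 * s) ^ n * ww n) := by
    filter_upwards [leb hb c hR] with x hx hxG
    have hex := hx l (by linarith [hxG.2])
    classical
    have hk := Nat.find_spec hex
    have hmin := fun m => Nat.find_min hex (m := m)
    set k := Nat.find hex with hkdef
    have hxm : dist x x0 < R := hxG.1
    have hsub : ∀ s ≤ R, ∫ y in ball x s, |b y - c| ≤ N * ((2 * R) ^ n * ww n) := by
      intro s hs
      refine le_trans ?_ hmass
      refine setIntegral_mono_set (intOnAbs hb c x0 (2 * R))
        (ae_of_all _ fun y => abs_nonneg _) (LE.le.eventuallyLE ?_)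
      exact ball_subset_ball' (by linarith)
    have hk0 : k ≠ 0 := by
      intro h0
      rw [h0] at hk
      have h1 := hsub (R * (1 / 10) ^ 0) (by simp)
      have h2 : N * ((2 * R) ^ n * ww n) ≤ l * ((R * (1 / 10) ^ 0) ^ n * ww n) := by
        rw [hl, mul_pow, pow_zero, mul_one]
        have : (2 : ℝ) ^ n ≤ 20 ^ n := pow_le_pow_left₀ (by norm_num) (by norm_num) n
        have h3 : 0 < N * (R ^ n * ww n) := by positivity
        have h4 : (0 : ℝ) < 20 ^ n := by positivity
        nlinarith
      linarith
    obtain ⟨m, hm⟩ := Nat.exists_eq_succ_of_ne_zero hk0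
    rw [hm] at hk
    have hmm := hmin m (by omega)
    have h10 : 10 * (R * (1 / 10 : ℝ) ^ (m + 1)) = R * (1 / 10) ^ m := by ring
    refine ⟨R * (1 / 10) ^ (m + 1), by positivity, ?_, hk, ?_⟩
    · have : (1 / 10 : ℝ) ^ m ≤ 1 := pow_le_one₀ (by norm_num) (by norm_num)
      rw [pow_succ]
      nlinarith
    · rw [h10]; exact not_lt.1 hmm
  set G' := {x | x ∈ G ∧ ∃ s : ℝ, 0 < s ∧ s ≤ R / 10 ∧
      l * (s ^ n * ww n) < ∫ y in ball x s, |b y - c| ∧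
      ∫ y in ball x (10 * s), |b y - c| ≤ l * ((10 * s) ^ n * ww n)} with hG'
  have hGG' : volume G ≤ volume G' := by
    apply measure_mono_ae
    filter_upwards [stopping] with x hx hxG
    exact ⟨hxG, hx hxG⟩
  refine hGG'.trans ?_
  have hch : ∀ x : EuclideanSpace ℝ (Fin n), ∃ s : ℝ, x ∈ G' → (0 < s ∧ s ≤ R / 10 ∧
      l * (s ^ n * ww n) < ∫ y in ball x s, |b y - c| ∧
      ∫ y in ball x (10 * s), |b y - c| ≤ l * ((10 * s) ^ n * ww n)) := by
    intro x
    by_cases hx : x ∈ G'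
    · obtain ⟨s, hs⟩ := hx.2
      exact ⟨s, fun _ => hs⟩
    · exact ⟨0, fun h => absurd h hx⟩
  choose s hs using hch
  obtain ⟨u, huG, hdisj, hcov⟩ := Vitali.exists_disjoint_subfamily_covering_enlargement_closedBall
    G' (fun x => x) s (R / 10) (fun a ha => (hs a ha).2.1) 4 (by norm_num)
  have hdisj' : u.PairwiseDisjoint fun a => ball a (s a) :=
    hdisj.mono fun a => ball_subset_closedBall
  have hcount : u.Countable := hdisj'.countable_of_isOpen (fun a _ => isOpen_ball)
    (fun a ha => ⟨a, mem_ball_self (hs a (huG ha)).1⟩)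
  have hsubset : G' ⊆ ⋃ a ∈ u, {y | y ∈ ball a (5 * s a) ∧ t < |b y - cB n b a (2 * (5 * s a))|} := by
    intro y hy
    obtain ⟨a, hau, ha⟩ := hcov y hy
    have hsa := hs a (huG hau)
    have hy1 : y ∈ closedBall a (4 * s a) := ha (mem_closedBall_self (hs y hy).1.le)
    refine mem_biUnion hau ⟨?_, ?_⟩
    · exact closedBall_subset_ball (by linarith [hsa.1]) hy1
    · have h1 := cdiff hb x0 a (r := 2 * R) (r' := 10 * s a) (by linarith [hsa.1])
        (by linarith [hsa.2.1])
      have h2 := h1.trans hsa.2.2.2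
      have hp : 0 < (10 * s a) ^ n * ww n := by have := hsa.1; positivity
      have h3 := le_of_mul_le_mul_right h2 hp
      have h4 : 2 * (5 * s a) = 10 * s a := by ring
      rw [h4]
      have h5 : t + l < |b y - c| := hy.1.2
      have h6 : |b y - c| ≤ |b y - cB n b a (10 * s a)| + |cB n b a (10 * s a) - c| :=
        abs_sub_le _ _ _
      linarith
  have integ_f := intOnAbs hb c x0 (2 * R)
  have hsubB : ∀ a ∈ u, ball a (s a) ⊆ ball x0 (2 * R) := by
    intro a ha
    have h1 : dist a x0 < R := (huG ha).1.1
    exact ball_subset_ball' (by linarith [(hs a (huG ha)).2.1])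
  calc volume G' ≤ volume (⋃ a ∈ u, {y | y ∈ ball a (5 * s a) ∧
        t < |b y - cB n b a (2 * (5 * s a))|}) := measure_mono hsubset
    _ ≤ ∑' a : u, volume {y | y ∈ ball (a : EuclideanSpace ℝ (Fin n)) (5 * s a) ∧
        t < |b y - cB n b a (2 * (5 * s a))|} := measure_biUnion_le _ hcount _
    _ ≤ ∑' a : u, ENNReal.ofReal (ε * 5 ^ n / l) *
          ∫⁻ y in ball (a : EuclideanSpace ℝ (Fin n)) (s a), ENNReal.ofReal |b y - c| := by
        refine ENNReal.tsum_le_tsum fun a => ?_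
        have hsa := hs a (huG a.2)
        have hsp := hsa.1
        refine (hP a (5 * s a) (by linarith)).trans ?_
        rw [← ofReal_integral_eq_lintegral_ofReal (integ_f.mono_set (hsubB a a.2))
          (ae_of_all _ fun y => abs_nonneg _), ← ENNReal.ofReal_mul (by positivity)]
        apply ENNReal.ofReal_le_ofReal
        have h1 := mul_le_mul_of_nonneg_left hsa.2.2.1.le (by positivity : 0 ≤ ε * 5 ^ n / l)
        refine le_trans (le_of_eq ?_) h1
        rw [mul_pow]
        field_simp
    _ = ENNReal.ofReal (ε * 5 ^ n / l) *
          ∫⁻ y in ⋃ a ∈ u, ball a (s a), ENNReal.ofReal |b y - c| := by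
        rw [ENNReal.tsum_mul_left, lintegral_biUnion hcount (fun _ _ => measurableSet_ball) hdisj']
    _ ≤ ENNReal.ofReal (ε * 5 ^ n / l) *
          ∫⁻ y in ball x0 (2 * R), ENNReal.ofReal |b y - c| := by
        gcongr
        exact iUnion₂_subset hsubB
    _ ≤ ENNReal.ofReal (ε * 5 ^ n / l) * ENNReal.ofReal (N * ((2 * R) ^ n * ww n)) := by
        gcongr
        rw [← ofReal_integral_eq_lintegral_ofReal integ_f (ae_of_all _ fun y => abs_nonneg _)]
        exact ENNReal.ofReal_le_ofReal hmass
    _ ≤ ENNReal.ofReal (ε / 2 * (R ^ n * ww n)) := by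
        rw [← ENNReal.ofReal_mul (by positivity)]
        apply ENNReal.ofReal_le_ofReal
        rw [hl, mul_pow]
        have h1 : (5 : ℝ) ^ n * 2 ^ n ≤ 20 ^ n := by
          rw [← mul_pow]; exact pow_le_pow_left₀ (by norm_num) (by norm_num) n
        have : ε * 5 ^ n / (2 * 20 ^ n * N) * (N * (2 ^ n * R ^ n * ww n)) =
            (ε / 2 * (R ^ n * ww n)) * ((5 ^ n * 2 ^ n) / 20 ^ n) := by
          field_simp
        rw [this]
        apply mul_le_of_le_one_right (by positivity)
        rw [div_le_one (by positivity)]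
        exact h1

lemma iter {n : ℕ} {b : EuclideanSpace ℝ (Fin n) → ℝ} (hb : LocallyIntegrable b volume)
    {N : ℝ} (hN : 0 < N) (hyp : Hyp n b N) (k : ℕ) :
    P n b (k * (2 * 20 ^ n * N)) ((1 / 2) ^ k) := by
  induction k with
  | zero =>
    intro x R hR
    rw [pow_zero, one_mul, ← vol_ball' n x hR]
    exact measure_mono fun y hy => hy.1
  | succ k ih =>
    have h := step hb hN hyp (by positivity) (by positivity) ih
    have e1 : ((k + 1 : ℕ) : ℝ) * (2 * 20 ^ n * N) = k * (2 * 20 ^ n * N) + 2 * 20 ^ n * N := by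
      push_cast; ring
    have e2 : ((1 : ℝ) / 2) ^ (k + 1) = (1 / 2) ^ k / 2 := by ring
    rw [e1, e2]
    exact h

lemma summ (p : ℝ) (a : ℝ) {q : ℝ} (hq0 : 0 ≤ q) (hq : q < 1) (ha : 0 ≤ a) :
    Summable fun k : ℕ => ((k : ℝ) + 1 + a) ^ p * q ^ k := by
  obtain ⟨m, hm⟩ := exists_nat_ge p
  have h1 : Summable fun k : ℕ => ((k : ℝ)) ^ m * q ^ k :=
    summable_pow_mul_geometric_of_norm_lt_one m (by rwa [Real.norm_of_nonneg hq0])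
  have h2 : Summable fun k : ℕ => q ^ k := summable_geometric_of_lt_one hq0 hq
  refine Summable.of_nonneg_of_le (fun k => by positivity) (fun k => ?_)
    ((h1.mul_left ((2 : ℝ) ^ m)).add (h2.mul_left ((2 * (1 + a)) ^ m)))
  rw [← mul_assoc, ← add_mul, ← mul_pow]
  gcongr
  calc ((k : ℝ) + 1 + a) ^ p ≤ ((k : ℝ) + 1 + a) ^ (m : ℝ) :=
        Real.rpow_le_rpow_of_exponent_le (by linarith [k.cast_nonneg (α := ℝ)]) hm
    _ = ((k : ℝ) + 1 + a) ^ m := Real.rpow_natCast _ _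
    _ ≤ _ := by
      rcases le_total (k : ℝ) (1 + a) with h | h
      · have : ((k : ℝ) + 1 + a) ^ m ≤ (2 * (1 + a)) ^ m := by gcongr; linarith
        have : 0 ≤ (2 * (k : ℝ)) ^ m := by positivity
        linarith
      · have : ((k : ℝ) + 1 + a) ^ m ≤ (2 * (k : ℝ)) ^ m := by gcongr; linarith
        have : 0 ≤ (2 * (1 + a)) ^ m := by positivity
        linarith

/-- John-Nirenberg constant -/
noncomputable def KK (n : ℕ) (p : ℝ) : ℝ :=
  (2 * 20 ^ n) ^ p * ∑' k : ℕ, ((k : ℝ) + 1 + 0) ^ p * (1 / 2) ^ k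

lemma KK_nonneg (n : ℕ) (p : ℝ) : 0 ≤ KK n p := by
  unfold KK
  have : 0 ≤ ∑' k : ℕ, ((k : ℝ) + 1 + 0) ^ p * (1 / 2) ^ k := tsum_nonneg fun k => by positivity
  positivity

lemma jn {n : ℕ} {b : EuclideanSpace ℝ (Fin n) → ℝ} (hb : LocallyIntegrable b volume)
    {N : ℝ} (hN : 0 < N) (hyp : Hyp n b N) {p : ℝ} (hp : 1 ≤ p)
    (x : EuclideanSpace ℝ (Fin n)) {R : ℝ} (hR : 0 < R) :
    ∫⁻ y in ball x R, ENNReal.ofReal (|b y - cB n b x (2 * R)| ^ p) ≤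
      ENNReal.ofReal (KK n p * N ^ p * (R ^ n * ww n)) := by
  have hw := ww_pos n
  set c := cB n b x (2 * R)
  set l : ℝ := 2 * 20 ^ n * N with hl
  have hlpos : 0 < l := by positivity
  set S : ℕ → Set (EuclideanSpace ℝ (Fin n)) := fun k => {y | (k : ℝ) * l < |b y - c|} with hS
  have hmeas : ∀ k, NullMeasurableSet (S k) (volume.restrict (ball x R)) := by
    intro k
    have h : AEMeasurable (fun y => |b y - c|) (volume.restrict (ball x R)) :=
      (intOnAbs hb c x R).aemeasurable
    exact nullMeasurableSet_lt aemeasurable_const h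
  have hpt : ∀ y, ENNReal.ofReal (|b y - c| ^ p) ≤
      ∑' k : ℕ, (S k).indicator (fun _ => ENNReal.ofReal ((((k : ℝ) + 1) * l) ^ p)) y := by
    intro y
    rcases (abs_nonneg (b y - c)).eq_or_lt with h0 | h0
    · rw [← h0, Real.zero_rpow (by linarith)]; simp
    · have hpos : 0 < ⌈|b y - c| / l⌉₊ := Nat.ceil_pos.2 (by positivity)
      obtain ⟨k, hk⟩ := Nat.exists_eq_succ_of_ne_zero hpos.ne'
      have h1 : (k : ℝ) * l < |b y - c| := by
        have : k < ⌈|b y - c| / l⌉₊ := by omega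
        rw [Nat.lt_ceil, lt_div_iff₀ hlpos] at this
        exact this
      have h2 : |b y - c| ≤ ((k : ℝ) + 1) * l := by
        have := Nat.le_ceil (|b y - c| / l)
        rw [hk, div_le_iff₀ hlpos] at this
        push_cast at this
        exact this
      refine le_trans ?_ (ENNReal.le_tsum k)
      rw [indicator_of_mem (show y ∈ S k from h1)]
      apply ENNReal.ofReal_le_ofReal
      exact Real.rpow_le_rpow h0.le h2 (by linarith)
  have hsum := summ p 0 (q := 1 / 2) (by norm_num) (by norm_num) le_rfl
  calc _ ≤ ∫⁻ y in ball x R, ∑' k : ℕ,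
          (S k).indicator (fun _ => ENNReal.ofReal ((((k : ℝ) + 1) * l) ^ p)) y :=
        lintegral_mono hpt
    _ = ∑' k : ℕ, ∫⁻ y in ball x R,
          (S k).indicator (fun _ => ENNReal.ofReal ((((k : ℝ) + 1) * l) ^ p)) y :=
        lintegral_tsum fun k => aemeasurable_const.indicator₀ (hmeas k)
    _ ≤ ∑' k : ℕ, ENNReal.ofReal (l ^ p * (R ^ n * ww n) *
          (((k : ℝ) + 1 + 0) ^ p * (1 / 2) ^ k)) := by
        refine ENNReal.tsum_le_tsum fun k => ?_
        refine (lintegral_indicator_const_le _ _).trans ?_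
        have h1 : (volume.restrict (ball x R)) (S k) ≤
            ENNReal.ofReal ((1 / 2) ^ k * (R ^ n * ww n)) := by
          rw [Measure.restrict_apply₀ (hmeas k)]
          refine le_trans (measure_mono ?_) (iter hb hN hyp k x R hR)
          exact fun y hy => ⟨hy.2, hy.1⟩
        refine (mul_le_mul_right h1 _).trans ?_
        rw [← ENNReal.ofReal_mul (by positivity)]
        apply ENNReal.ofReal_le_ofReal
        rw [Real.mul_rpow (by positivity) hlpos.le, add_zero]
        apply le_of_eq; ring
    _ = ENNReal.ofReal (l ^ p * (R ^ n * ww n) *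
          ∑' k : ℕ, (((k : ℝ) + 1 + 0) ^ p * (1 / 2) ^ k)) := by
        rw [← tsum_mul_left, ENNReal.ofReal_tsum_of_nonneg (fun k => by positivity)
          (hsum.mul_left _)]
    _ = _ := by
        congr 1
        rw [hl, Real.mul_rpow (by positivity) hN.le, KK]
        ring

lemma chain1 {n : ℕ} {b : EuclideanSpace ℝ (Fin n) → ℝ} (hb : LocallyIntegrable b volume)
    {N : ℝ} (hyp : Hyp n b N) (x : EuclideanSpace ℝ (Fin n)) {s : ℝ} (hs : 0 < s) :
    |cB n b x s - cB n b x (2 * s)| ≤ 2 ^ n * N := by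
  have hw := ww_pos n
  have h1 := cdiff hb x x (r := 2 * s) hs (by linarith)
  have h2 : ∫ y in ball x s, |b y - cB n b x (2 * s)| ≤
      ∫ y in ball x (2 * s), |b y - cB n b x (2 * s)| := by
    refine setIntegral_mono_set (intOnAbs hb _ x (2 * s))
        (ae_of_all _ fun y => abs_nonneg _) (LE.le.eventuallyLE ?_)
    exact ball_subset_ball (by linarith)
  have h3 := hyp x (2 * s) (by positivity)
  refine le_of_mul_le_mul_right (h1.trans (h2.trans (h3.trans (le_of_eq ?_))))
    (by positivity : 0 < s ^ n * ww n)
  rw [mul_pow]; ring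

lemma chain {n : ℕ} {b : EuclideanSpace ℝ (Fin n) → ℝ} (hb : LocallyIntegrable b volume)
    {N : ℝ} (hyp : Hyp n b N) (x : EuclideanSpace ℝ (Fin n)) {r : ℝ} (hr : 0 < r) (j : ℕ) :
    |cB n b x (2 ^ j * r) - cB n b x r| ≤ j * (2 ^ n * N) := by
  induction j with
  | zero => simp
  | succ j ih =>
    have h := chain1 hb hyp x (s := 2 ^ j * r) (by positivity)
    rw [abs_sub_comm] at h
    have e : (2 : ℝ) ^ (j + 1) * r = 2 * (2 ^ j * r) := by ring
    rw [e]
    have := abs_sub_le (cB n b x (2 * (2 ^ j * r))) (cB n b x (2 ^ j * r)) (cB n b x r)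
    push_cast
    linarith

lemma pow_add_le {u v p : ℝ} (hu : 0 ≤ u) (hv : 0 ≤ v) (hp : 1 ≤ p) :
    (u + v) ^ p ≤ 2 ^ p * (u ^ p + v ^ p) := by
  have hu' : 0 ≤ u ^ p := by positivity
  have hv' : 0 ≤ v ^ p := by positivity
  have h2 : (0 : ℝ) ≤ 2 ^ p := by positivity
  rcases le_total u v with h | h
  · calc (u + v) ^ p ≤ (2 * v) ^ p := Real.rpow_le_rpow (by linarith) (by linarith) (by linarith)
      _ = 2 ^ p * v ^ p := Real.mul_rpow (by norm_num) hv
      _ ≤ _ := by gcongr; linarith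
  · calc (u + v) ^ p ≤ (2 * u) ^ p := Real.rpow_le_rpow (by linarith) (by linarith) (by linarith)
      _ = 2 ^ p * u ^ p := Real.mul_rpow (by norm_num) hu
      _ ≤ _ := by gcongr; linarith

/-- prefactor in the final constant -/
noncomputable def MM (n : ℕ) (p : ℝ) : ℝ :=
  2 ^ p * 2 ^ n * ww n * (KK n p + (2 ^ n) ^ p)

lemma MM_nonneg (n : ℕ) (p : ℝ) : 0 ≤ MM n p := by
  have := KK_nonneg n p
  have := ww_pos n
  unfold MM
  positivity

lemma annulus {n : ℕ} {b : EuclideanSpace ℝ (Fin n) → ℝ} (hb : LocallyIntegrable b volume)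
    {N : ℝ} (hN : 0 < N) (hyp : Hyp n b N) {p δ : ℝ} (hp : 1 ≤ p) (hδ : 0 < δ)
    (x : EuclideanSpace ℝ (Fin n)) {r : ℝ} (hr : 0 < r) (j : ℕ) :
    ∫⁻ y in {y | 2 ^ j * r ≤ ‖y - x‖ ∧ ‖y - x‖ < 2 ^ (j + 1) * r},
      ENNReal.ofReal (|b y - cB n b x r| ^ p / ‖y - x‖ ^ ((n : ℝ) + δ)) ≤
      ENNReal.ofReal (r ^ (-δ) * N ^ p * MM n p *
        (((j : ℝ) + 1 + 1) ^ p * ((2 : ℝ) ^ (-δ)) ^ j)) := by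
  have hw := ww_pos n
  have hK := KK_nonneg n p
  set A := {y : EuclideanSpace ℝ (Fin n) | 2 ^ j * r ≤ ‖y - x‖ ∧ ‖y - x‖ < 2 ^ (j + 1) * r} with hA
  set s : ℝ := 2 ^ j * r with hs
  have hspos : 0 < s := by positivity
  have hs2 : (2 : ℝ) ^ (j + 1) * r = 2 * s := by rw [hs]; ring
  have hs4 : (2 : ℝ) ^ (j + 2) * r = 2 * (2 * s) := by rw [hs]; ring
  set c := cB n b x (2 * (2 * s)) with hc
  set m : ℝ := ((((j : ℝ) + 1 + 1)) * (2 ^ n * N)) ^ p with hm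
  have hm0 : 0 ≤ m := by positivity
  set D : ℝ := 2 ^ p / s ^ ((n : ℝ) + δ) with hD
  have hD0 : 0 ≤ D := by positivity
  have hAm : MeasurableSet A := by
    have h1 : Measurable fun y : EuclideanSpace ℝ (Fin n) => ‖y - x‖ := by fun_prop
    exact (measurableSet_le measurable_const h1).inter (measurableSet_lt h1 measurable_const)
  have hAsub : A ⊆ ball x (2 * s) := by
    intro y hy
    rw [mem_ball, dist_eq_norm, ← hs2]
    exact hy.2
  have hcc : |c - cB n b x r| ≤ ((j : ℝ) + 1 + 1) * (2 ^ n * N) := by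
    have := chain hb hyp x hr (j + 2)
    rw [hs4] at this
    push_cast at this
    rw [add_assoc, one_add_one_eq_two]
    exact this
  have hpt : ∀ y ∈ A, ENNReal.ofReal (|b y - cB n b x r| ^ p / ‖y - x‖ ^ ((n : ℝ) + δ)) ≤
      ENNReal.ofReal D * (ENNReal.ofReal (|b y - c| ^ p) + ENNReal.ofReal m) := by
    intro y hy
    rw [← ENNReal.ofReal_add (by positivity) hm0, ← ENNReal.ofReal_mul hD0]
    apply ENNReal.ofReal_le_ofReal
    have h1 : |b y - cB n b x r| ^ p ≤ 2 ^ p * (|b y - c| ^ p + m) := by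
      calc |b y - cB n b x r| ^ p ≤ (|b y - c| + ((j : ℝ) + 1 + 1) * (2 ^ n * N)) ^ p := by
            apply Real.rpow_le_rpow (abs_nonneg _) _ (by linarith)
            have := abs_sub_le (b y) c (cB n b x r)
            linarith
        _ ≤ _ := pow_add_le (abs_nonneg _) (by positivity) hp
    have h2 : s ^ ((n : ℝ) + δ) ≤ ‖y - x‖ ^ ((n : ℝ) + δ) :=
      Real.rpow_le_rpow hspos.le hy.1 (by positivity)
    have h3 : D * (|b y - c| ^ p + m) = (2 ^ p * (|b y - c| ^ p + m)) / s ^ ((n : ℝ) + δ) := by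
      rw [hD]; ring
    rw [h3]
    exact div_le_div₀ (by positivity) h1 (by positivity) h2
  calc _ ≤ ∫⁻ y in A, ENNReal.ofReal D * (ENNReal.ofReal (|b y - c| ^ p) + ENNReal.ofReal m) :=
        setLIntegral_mono' hAm hpt
    _ ≤ ∫⁻ y in ball x (2 * s),
          ENNReal.ofReal D * (ENNReal.ofReal (|b y - c| ^ p) + ENNReal.ofReal m) :=
        lintegral_mono_set hAsub
    _ = ENNReal.ofReal D * ((∫⁻ y in ball x (2 * s), ENNReal.ofReal (|b y - c| ^ p)) +
          ENNReal.ofReal m * volume (ball x (2 * s))) := by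
        rw [lintegral_const_mul' _ _ ENNReal.ofReal_ne_top,
          lintegral_add_right _ measurable_const, setLIntegral_const]
    _ ≤ ENNReal.ofReal D * (ENNReal.ofReal (KK n p * N ^ p * ((2 * s) ^ n * ww n)) +
          ENNReal.ofReal m * ENNReal.ofReal ((2 * s) ^ n * ww n)) := by
        rw [vol_ball' n x (by positivity)]
        gcongr
        exact jn hb hN hyp hp x (R := 2 * s) (by positivity)
    _ = ENNReal.ofReal (D * (KK n p * N ^ p * ((2 * s) ^ n * ww n) +
          m * ((2 * s) ^ n * ww n))) := by
        rw [← ENNReal.ofReal_mul hm0, ← ENNReal.ofReal_add (by positivity) (by positivity),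
          ← ENNReal.ofReal_mul hD0]
    _ ≤ _ := by
        apply ENNReal.ofReal_le_ofReal
        set J : ℝ := ((j : ℝ) + 1 + 1) ^ p with hJ
        have hJ1 : 1 ≤ J := Real.one_le_rpow (by linarith [j.cast_nonneg (α := ℝ)]) (by linarith)
        have e1 : m = J * ((2 ^ n) ^ p * N ^ p) := by
          rw [hm, Real.mul_rpow (by positivity) (by positivity),
            Real.mul_rpow (by positivity) hN.le]
        have e2 : s ^ ((n : ℝ) + δ) = s ^ n * s ^ δ := by
          rw [Real.rpow_add hspos, Real.rpow_natCast]
        have e3 : r ^ (-δ) * ((2 : ℝ) ^ (-δ)) ^ j = (s ^ δ)⁻¹ := by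
          rw [hs, ← Real.rpow_neg (by positivity), Real.mul_rpow (by positivity) hr.le,
            ← Real.rpow_natCast, ← Real.rpow_mul (by norm_num), ← Real.rpow_natCast,
            ← Real.rpow_mul (by norm_num), mul_comm, mul_comm (j : ℝ)]
        have e4 : r ^ (-δ) * N ^ p * MM n p * (J * ((2 : ℝ) ^ (-δ)) ^ j) =
            (s ^ δ)⁻¹ * N ^ p * MM n p * J := by rw [← e3]; ring
        have e5 : D * (KK n p * N ^ p * ((2 * s) ^ n * ww n) + m * ((2 * s) ^ n * ww n)) =
            (s ^ δ)⁻¹ * N ^ p * (2 ^ p * 2 ^ n * ww n) * (KK n p + J * (2 ^ n) ^ p) := by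
          rw [hD, e1, e2, mul_pow 2 s n]
          have : 0 < s ^ δ := by positivity
          field_simp
        rw [e4, e5, MM]
        have : KK n p ≤ J * KK n p := le_mul_of_one_le_left hK hJ1
        calc _ ≤ (s ^ δ)⁻¹ * N ^ p * (2 ^ p * 2 ^ n * ww n) * (J * KK n p + J * (2 ^ n) ^ p) := by
              gcongr
          _ = _ := by ring

lemma core {n : ℕ} {b : EuclideanSpace ℝ (Fin n) → ℝ} (hb : LocallyIntegrable b volume)
    {N : ℝ} (hN : 0 < N) (hyp : Hyp n b N) {p δ : ℝ} (hp : 1 ≤ p) (hδ : 0 < δ)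
    (x : EuclideanSpace ℝ (Fin n)) {r : ℝ} (hr : 0 < r) :
    r ^ δ * ∫ y in {y : EuclideanSpace ℝ (Fin n) | r < ‖y - x‖},
            |b y - cB n b x r| ^ p / ‖y - x‖ ^ ((n : ℝ) + δ) ≤
      (MM n p * ∑' j : ℕ, (((j : ℝ) + 1 + 1) ^ p * ((2 : ℝ) ^ (-δ)) ^ j) + 1) * N ^ p := by
  set T := ∑' j : ℕ, (((j : ℝ) + 1 + 1) ^ p * ((2 : ℝ) ^ (-δ)) ^ j) with hT
  have hT0 : 0 ≤ T := tsum_nonneg fun j => by positivity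
  have hM := MM_nonneg n p
  have hNp : 0 < N ^ p := by positivity
  have hsum := summ p 1 (q := (2 : ℝ) ^ (-δ)) (by positivity)
    (Real.rpow_lt_one_of_one_lt_of_neg (by norm_num) (by linarith)) zero_le_one
  set f : EuclideanSpace ℝ (Fin n) → ℝ :=
    fun y => |b y - cB n b x r| ^ p / ‖y - x‖ ^ ((n : ℝ) + δ) with hf
  have hf0 : ∀ y, 0 ≤ f y := fun y => by simp only [hf]; positivity
  by_cases hi : Integrable f (volume.restrict {y : EuclideanSpace ℝ (Fin n) | r < ‖y - x‖})
  swap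
  · rw [integral_undef hi, mul_zero]
    positivity
  have hlin : ∫⁻ y in {y : EuclideanSpace ℝ (Fin n) | r < ‖y - x‖}, ENNReal.ofReal (f y) ≤
      ENNReal.ofReal (r ^ (-δ) * N ^ p * MM n p * T) := by
    calc _ ≤ ∫⁻ y in ⋃ j : ℕ, {y : EuclideanSpace ℝ (Fin n) |
            2 ^ j * r ≤ ‖y - x‖ ∧ ‖y - x‖ < 2 ^ (j + 1) * r}, ENNReal.ofReal (f y) := by
          apply lintegral_mono_set
          intro y hy
          have hy' : r < ‖y - x‖ := hy
          obtain ⟨j, h1, h2⟩ := exists_nat_pow_near (x := ‖y - x‖ / r) (y := (2 : ℝ))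
            (by rw [one_le_div hr]; exact hy'.le) (by norm_num)
          rw [le_div_iff₀ hr] at h1
          rw [div_lt_iff₀ hr] at h2
          exact mem_iUnion.2 ⟨j, h1, h2⟩
      _ ≤ ∑' j : ℕ, ∫⁻ y in {y : EuclideanSpace ℝ (Fin n) |
            2 ^ j * r ≤ ‖y - x‖ ∧ ‖y - x‖ < 2 ^ (j + 1) * r}, ENNReal.ofReal (f y) :=
          lintegral_iUnion_le _ _
      _ ≤ ∑' j : ℕ, ENNReal.ofReal (r ^ (-δ) * N ^ p * MM n p *
            (((j : ℝ) + 1 + 1) ^ p * ((2 : ℝ) ^ (-δ)) ^ j)) :=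
          ENNReal.tsum_le_tsum fun j => annulus hb hN hyp hp hδ x hr j
      _ = _ := by
          rw [hT, ← tsum_mul_left, ENNReal.ofReal_tsum_of_nonneg (fun k => by positivity)
            (hsum.mul_left _)]
  rw [← ofReal_integral_eq_lintegral_ofReal hi (ae_of_all _ hf0),
    ENNReal.ofReal_le_ofReal_iff (by positivity)] at hlin
  calc _ ≤ r ^ δ * (r ^ (-δ) * N ^ p * MM n p * T) := by gcongr
    _ = (r ^ δ * r ^ (-δ)) * (MM n p * T * N ^ p) := by ring
    _ = MM n p * T * N ^ p := by rw [← Real.rpow_add hr]; simp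
    _ ≤ _ := by linarith

end BmoTail

/-- the bmo tail integral estimate
`r^δ ∫_{|x−x₀|>r} |b − c_{B(x₀,r)}|^p / |x−x₀|^{n+δ} ≤ C(n,p,δ) ‖b‖_bmo^p`. -/
theorem bmo_tail_estimate (n : ℕ) (p δ : ℝ) (hp : 1 ≤ p) (hδ : 0 < δ) :
    ∃ C > (0 : ℝ), ∀ (b : EuclideanSpace ℝ (Fin n) → ℝ) (Nb : ℝ),
      LocallyIntegrable b volume →
      (∀ (x₀ : EuclideanSpace ℝ (Fin n)) (r : ℝ), 0 < r →
        ⨍ x in Metric.ball x₀ r, |b x - cB n b x₀ r| ≤ Nb) →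
      ∀ (x₀ : EuclideanSpace ℝ (Fin n)) (r : ℝ), 0 < r →
        r ^ δ * ∫ x in {x : EuclideanSpace ℝ (Fin n) | r < ‖x - x₀‖},
            |b x - cB n b x₀ r| ^ p / ‖x - x₀‖ ^ ((n : ℝ) + δ)
          ≤ C * Nb ^ p := by
  refine ⟨BmoTail.MM n p * ∑' j : ℕ, (((j : ℝ) + 1 + 1) ^ p * ((2 : ℝ) ^ (-δ)) ^ j) + 1, ?_, ?_⟩
  · have h1 := BmoTail.MM_nonneg n p
    have h2 : 0 ≤ ∑' j : ℕ, (((j : ℝ) + 1 + 1) ^ p * ((2 : ℝ) ^ (-δ)) ^ j) :=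
      tsum_nonneg fun j => by positivity
    positivity
  intro b Nb hb hyp x₀ r hr
  have hNb : 0 ≤ Nb := by
    refine le_trans ?_ (hyp x₀ r hr)
    rw [setAverage_eq, smul_eq_mul]
    exact mul_nonneg (by positivity) (integral_nonneg fun y => abs_nonneg _)
  have key : ∀ M : ℝ, Nb < M → _ := fun M hM =>
    BmoTail.core (N := M) hb (hNb.trans_lt hM) (fun x s hs => by
      have hw := BmoTail.ww_pos n
      rw [← BmoTail.avg_eq n _ x hs]
      gcongr
      exact (hyp x s hs).trans hM.le) hp hδ x₀ hr
  have hcont : Continuous fun M : ℝ =>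
      (BmoTail.MM n p * ∑' j : ℕ, (((j : ℝ) + 1 + 1) ^ p * ((2 : ℝ) ^ (-δ)) ^ j) + 1) * M ^ p :=
    continuous_const.mul (Real.continuous_rpow_const (by linarith))
  refine ge_of_tendsto (hcont.continuousWithinAt (s := Ioi Nb) (x := Nb)) ?_
  filter_upwards [self_mem_nhdsWithin] with M hM
  exact key M hM
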